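/- An approximate abstraction need not decompose as an exact abstraction of an approximation: there exist recursive causal models (M_L, I_L) with one exogenous variable U with R(U) = {0} and binary endogenous variables A, B, C (all equations being V = U), I_L = {∅, B ← 1, B ← 0, A ← 1, A ← 0}, and (M_H, I_H) with one exogenous variable U with R(U) = {0} and binary endogenous variables D, E (all equations V = U), I_H = {∅}, together with the surjective map τ(a, b, c) = (a ⊕ b, b ⊕ c) (⊕ denoting addition mod 2), such that, with the Euclidean metric on R(V_H) = {0,1}², (M_H, I_H) is a τ-√2-approximate abstraction of (M_L, I_L), yet there exists NO recursive causal model (M_L', I_L) similar to (M_L, I_L) such that (M_H, I_H) is an exact τ-abstraction of (M_L', I_L). -/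

import Mathlib

open Classical

/-- An intervention `X ← x`, as a partial assignment of values to the
endogenous variables. -/
abbrev Intervention (V : Type) (R : V → Type) : Type := ∀ v : V, Option (R v)

/-- `Rst i` is the set of endogenous states that agree with intervention `i`
on all intervened variables. -/
def Rst {V : Type} {R : V → Type} (i : Intervention V R) : Set (∀ v, R v) :=
  {s | ∀ (v : V) (a : R v), i v = some a → s v = a}

/-- `g` depends on variable `w` if changing only the value of `w` can change
the value of `g`. -/
def DependsOnVar {V : Type} {R : V → Type} {A : Type}
    (g : (∀ v, R v) → A) (w : V) : Prop :=
  ∃ s s' : ∀ v, R v, (∀ z, z ≠ w → s z = s' z) ∧ g s ≠ g s'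

/-- A structural causal model: each endogenous variable has a structural
equation. -/
structure SCM (Ctx V : Type) (R : V → Type) where
  F : ∀ v : V, Ctx → (∀ w, R w) → R v

/-- Recursiveness: for each context there is a strict partial order `≺` on the
endogenous variables such that the equation of `v` depends on `w` only if
`w ≺ v`. -/
def SCM.Recursive {Ctx V : Type} {R : V → Type} (M : SCM Ctx V R) : Prop :=
  ∀ u : Ctx, ∃ ord : V → V → Prop, IsStrictOrder V ord ∧
    ∀ v w : V, DependsOnVar (M.F v u) w → ord w v

/-- `s` is a solution of model `M` in context `u` under intervention `i`. -/
def IsSolution {Ctx V : Type} {R : V → Type} (M : SCM Ctx V R) (u : Ctx)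
    (i : Intervention V R) (s : ∀ v, R v) : Prop :=
  ∀ v : V, s v = (i v).getD (M.F v u s)

/-- The distance `d_τ(M_L, M_H)`. -/
noncomputable def dTau {CtxL CtxH VL VH : Type} {RL : VL → Type} {RH : VH → Type}
    (dH : (∀ v, RH v) → (∀ v, RH v) → ℝ)
    (τ : (∀ v, RL v) → (∀ v, RH v))
    (ω : Intervention VL RL → Intervention VH RH)
    (IL : Set (Intervention VL RL))
    (ML : CtxL → Intervention VL RL → (∀ v, RL v))
    (MH : CtxH → Intervention VH RH → (∀ v, RH v)) : ℝ :=
  sInf {a | ∃ τU : CtxL → CtxH, Function.Surjective τU ∧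
      a = sSup {b | ∃ i ∈ IL, ∃ u : CtxL,
            b = dH (τ (ML u i)) (MH (τU u) (ω i))}}

/- The concrete example: one exogenous variable `U` with range `{0}`
(contexts `PUnit`); low-level binary endogenous variables `A, B, C`
(`VL = Fin 3`, `A = 0`, `B = 1`, `C = 2`); high-level binary endogenous
variables `D, E` (`VH = Fin 2`); all equations being `V = U`, i.e. constantly
`false`. -/

namespace Example11

abbrev VL := Fin 3
abbrev VH := Fin 2
abbrev RL : VL → Type := fun _ => Bool
abbrev RH : VH → Type := fun _ => Bool
abbrev Ctx := PUnit

/-- `τ(a, b, c) = (a ⊕ b, b ⊕ c)`. -/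
def τ : (∀ v : VL, RL v) → (∀ v : VH, RH v) :=
  fun s j => if j = 0 then Bool.xor (s 0) (s 1) else Bool.xor (s 1) (s 2)

/-- The low-level model: all equations are `V = U`, i.e. constantly `0`. -/
def FL : SCM Ctx VL RL := ⟨fun _ _ _ => false⟩

/-- The semantics of the low-level model. -/
def ML : Ctx → Intervention VL RL → (∀ v : VL, RL v) :=
  fun _ i v => (i v).getD false

/-- The high-level model: all equations are `V = U`, i.e. constantly `0`. -/
def FH : SCM Ctx VH RH := ⟨fun _ _ _ => false⟩

/-- The semantics of the high-level model. -/
def MH : Ctx → Intervention VH RH → (∀ v : VH, RH v) :=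
  fun _ i v => (i v).getD false

/-- The empty intervention. -/
def emptyI {V : Type} {R : V → Type} : Intervention V R := fun _ => none

/-- The single-variable intervention `k ← b`. -/
def single (k : Fin 3) (b : Bool) : Intervention VL RL :=
  fun v => if v = k then some b else none

/-- `I_L = {∅, B ← 1, B ← 0, A ← 1, A ← 0}`. -/
def IL : Set (Intervention VL RL) :=
  {emptyI, single 1 true, single 1 false, single 0 true, single 0 false}

/-- `I_H = {∅}`. -/
def IH : Set (Intervention VH RH) := {emptyI}

/-- `ω_τ` maps every intervention of `I_L` to the empty intervention. -/
def ω : Intervention VL RL → Intervention VH RH := fun _ => emptyI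

/-- The Euclidean metric on `R(V_H) = {0, 1}²`. -/
noncomputable def dH : (∀ v : VH, RH v) → (∀ v : VH, RH v) → ℝ :=
  fun s t =>
    Real.sqrt (((if s 0 then (1 : ℝ) else 0) - (if t 0 then (1 : ℝ) else 0)) ^ 2
      + ((if s 1 then (1 : ℝ) else 0) - (if t 1 then (1 : ℝ) else 0)) ^ 2)

theorem dH_nonneg (s t : ∀ v : VH, RH v) : 0 ≤ dH s t := Real.sqrt_nonneg _

theorem dH_le (s t : ∀ v : VH, RH v) : dH s t ≤ Real.sqrt 2 := by
  unfold dH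
  apply Real.sqrt_le_sqrt
  cases s 0 <;> cases s 1 <;> cases t 0 <;> cases t 1 <;> norm_num

theorem tau_mk0 (b : Bool) (t : ∀ v : VH, RH v) :
    ∃ s : ∀ v : VL, RL v, s 0 = b ∧ τ s = t := by
  refine ⟨![b, Bool.xor b (t 0), Bool.xor (Bool.xor b (t 0)) (t 1)], rfl, ?_⟩
  funext j
  fin_cases j
  · simp [τ]
  · cases b <;> cases h0 : t 0 <;> cases h1 : t 1 <;> simp [τ, h0, h1]

theorem tau_mk1 (b : Bool) (t : ∀ v : VH, RH v) :
    ∃ s : ∀ v : VL, RL v, s 1 = b ∧ τ s = t := by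
  refine ⟨![Bool.xor (t 0) b, b, Bool.xor b (t 1)], rfl, ?_⟩
  funext j
  fin_cases j <;> simp [τ]

theorem depends_of_ne (g : (∀ v : VL, RL v) → Bool)
    (h : g (fun _ => false) ≠ g (fun _ => true)) : ∃ w, DependsOnVar g w := by
  by_contra hn
  have key : ∀ (w : VL) (s s' : ∀ v : VL, RL v), (∀ z, z ≠ w → s z = s' z) → g s = g s' := by
    intro w s s' hs
    by_contra hne
    exact hn ⟨w, s, s', hs, hne⟩
  have h1 := key 0 (fun _ => false) ![true, false, false]
    (by intro z hz; fin_cases z <;> simp_all)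
  have h2 := key 1 ![true, false, false] ![true, true, false]
    (by intro z hz; fin_cases z <;> simp_all)
  have h3 := key 2 ![true, true, false] (fun _ => true)
    (by intro z hz; fin_cases z <;> simp_all)
  exact h (h1.trans (h2.trans h3))

theorem const_of_tau (s : ∀ v : VL, RL v) (u : Ctx) (h : τ s = MH u emptyI) (k : VL) :
    s = fun _ => s k := by
  have h0 : (s 0 ^^ s 1) = false := by simpa [τ, MH, emptyI] using congrFun h 0
  have h1 : (s 1 ^^ s 2) = false := by simpa [τ, MH, emptyI] using congrFun h 1
  have e0 : s 0 = s 1 := by simpa using h0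
  have e1 : s 1 = s 2 := by simpa using h1
  funext v
  fin_cases v <;> fin_cases k <;> simp [e0, e1]

/-- an approximate abstraction need not decompose as an exact
abstraction of an approximation.  In the concrete example above: `M_L` and
`M_H` are recursive models with the stated semantics, `τ` is surjective,
`ω` is the induced map `ω_τ` on `I_L` with `I_H = ω_τ(I_L)`, `(M_H, I_H)` is
a τ-√2-approximate abstraction of `(M_L, I_L)` (w.r.t. the Euclidean metric),
yet there is NO recursive causal model `(M_L', I_L)` similar to `(M_L, I_L)`
such that `(M_H, I_H)` is an exact τ-abstraction of `(M_L', I_L)`. -/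
theorem no_decomposition_as_abstraction_of_approximation :
    FL.Recursive ∧ (∀ u i, IsSolution FL u i (ML u i)) ∧
    FH.Recursive ∧ (∀ u i, IsSolution FH u i (MH u i)) ∧
    Function.Surjective τ ∧
    (∀ i ∈ IL, τ '' Rst i = Rst (ω i)) ∧
    IH = ω '' IL ∧
    Fintype.card Ctx ≤ Fintype.card Ctx ∧
    dTau dH τ ω IL ML MH ≤ Real.sqrt 2 ∧
    ¬ ∃ (FL' : SCM Ctx VL RL)
        (ML' : Ctx → Intervention VL RL → (∀ v : VL, RL v)),
          FL'.Recursive ∧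
          (∀ u i, IsSolution FL' u i (ML' u i)) ∧
          ∃ τU : Ctx → Ctx, Function.Surjective τU ∧
            ∀ u : Ctx, ∀ i ∈ IL, τ (ML' u i) = MH (τU u) (ω i) := by
  refine ⟨?_, fun _ _ _ => rfl, ?_, fun _ _ _ => rfl, ?_, ?_, ?_, le_rfl, ?_, ?_⟩
  · intro u
    refine ⟨(· < ·), inferInstance, ?_⟩
    rintro v w ⟨s, s2, -, h⟩
    exact absurd rfl h
  · intro u
    refine ⟨(· < ·), inferInstance, ?_⟩
    rintro v w ⟨s, s2, -, h⟩
    exact absurd rfl h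
  · intro t
    obtain ⟨s, -, hs⟩ := tau_mk0 false t
    exact ⟨s, hs⟩
  · intro i hi
    have hu : Rst (ω i) = Set.univ := by
      ext t
      simp [Rst, ω, emptyI]
    rw [hu, Set.eq_univ_iff_forall]
    intro t
    have m0 : ∀ b, t ∈ τ '' Rst (single 0 b) := by
      intro b
      obtain ⟨s, h, hs⟩ := tau_mk0 b t
      refine ⟨s, ?_, hs⟩
      intro v a hv
      by_cases hk : v = 0
      · subst hk
        simp [single] at hv
        rw [h, hv]
      · simp [single, hk] at hv
    have m1 : ∀ b, t ∈ τ '' Rst (single 1 b) := by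
      intro b
      obtain ⟨s, h, hs⟩ := tau_mk1 b t
      refine ⟨s, ?_, hs⟩
      intro v a hv
      by_cases hk : v = 1
      · subst hk
        simp [single] at hv
        rw [h, hv]
      · simp [single, hk] at hv
    rcases hi with rfl | rfl | rfl | rfl | rfl
    · obtain ⟨s, -, hs⟩ := tau_mk0 false t
      exact ⟨s, fun v a hv => by simp [emptyI] at hv, hs⟩
    · exact m1 _
    · exact m1 _
    · exact m0 _
    · exact m0 _
  · ext x
    constructor
    · intro hx
      exact ⟨emptyI, Or.inl rfl, hx.symm⟩
    · rintro ⟨i, -, rfl⟩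
      rfl
  · refine le_trans (csInf_le ?_ ⟨id, Function.surjective_id, rfl⟩) ?_
    · refine ⟨0, ?_⟩
      rintro a ⟨τU, -, rfl⟩
      apply Real.sSup_nonneg
      rintro b ⟨i, -, u, rfl⟩
      exact dH_nonneg _ _
    · apply Real.sSup_le _ (Real.sqrt_nonneg _)
      rintro b ⟨i, -, u, rfl⟩
      exact dH_le _ _
  · rintro ⟨F, M, hrec, hsol, τU, -, h⟩
    obtain ⟨ord, hord, hdep⟩ := hrec PUnit.unit
    have hF : ∀ (k v : VL) (b : Bool), single k b ∈ IL → v ≠ k →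
        F.F v PUnit.unit (fun _ => b) = b := by
      intro k v b hi hvk
      have hc := const_of_tau _ _ (h PUnit.unit _ hi) k
      have hk : M PUnit.unit (single k b) k = b := by
        rw [hsol PUnit.unit (single k b) k]
        simp [single]
      rw [hk] at hc
      have hv := hsol PUnit.unit (single k b) v
      rw [hc] at hv
      simpa [single, hvk] using hv.symm
    have m0 : ∀ b, single 0 b ∈ IL := by intro b; cases b <;> simp [IL]
    have m1 : ∀ b, single 1 b ∈ IL := by intro b; cases b <;> simp [IL]
    have hall : ∀ (v : VL) (b : Bool), F.F v PUnit.unit (fun _ => b) = b := by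
      intro v b
      by_cases hv : v = 0
      · exact hF 1 v b (m1 b) (by rw [hv]; decide)
      · exact hF 0 v b (m0 b) hv
    have hpred : ∀ v, ∃ w, ord w v := by
      intro v
      obtain ⟨w, hw⟩ := depends_of_ne (F.F v PUnit.unit)
        (by rw [hall v false, hall v true]; decide)
      exact ⟨w, hdep v w hw⟩
    have wf : WellFounded ord := Finite.wellFounded_of_trans_of_irrefl ord
    obtain ⟨m, -, hm⟩ := wf.has_min Set.univ ⟨(0 : VL), trivial⟩
    obtain ⟨w, hw⟩ := hpred m
    exact hm w trivial hw

end Example11
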